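/- arXiv:2211.15747 — 2 statements merged into one kernel-verified Lean document; each statement's English description precedes it below -/
import Mathlib

section
/- Let m be a positive integer and M, N ⊆ [m]. Then the number of pairs (v, w) ∈ Z_2^m × Z_2^m with χ(v|M) = 0, χ(v|N) = 0, χ(w|M) = 0 and χ(v+w|M) = 0 equals {(2^{|M|} − 1)·2^{m−|M|} + (2^{|N|} − 1)·2^{m−|N|} − (2^{|M∪N|} − 1)·2^{m−|M∪N|}} · {(2^{|M|} − 2)·2^{m−|M|}}. -/
open Polynomial
open scoped Classical

noncomputable section

/-- The ring `R = Z₂[u]/⟨u³ - u⟩`. -/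
abbrev Rng : Type := AdjoinRoot (X ^ 3 - X : Polynomial (ZMod 2))

/-- The image `u` of the variable in `R`. -/
def u : Rng := AdjoinRoot.root (X ^ 3 - X : Polynomial (ZMod 2))

/-- The natural inclusion of `Z₂` into `R`. -/
def toRng : ZMod 2 →+* Rng := AdjoinRoot.of _

lemma cubic_monic : (X ^ 3 - X : Polynomial (ZMod 2)).Monic :=
  Polynomial.monic_X_pow_sub (n := 3) (Polynomial.degree_X_le.trans_lt (by norm_num))

/-- The Gray map `Φ : R → Z₂³`, `Φ(a + u b + u² d) = (a + b, b + d, d)`: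
every element of `R` is represented by a unique polynomial of degree `< 3`,
whose coefficients are `a, b, d`. -/
def Phi (r : Rng) : Fin 3 → ZMod 2 :=
  ![(AdjoinRoot.modByMonicHom cubic_monic r).coeff 0 +
      (AdjoinRoot.modByMonicHom cubic_monic r).coeff 1,
    (AdjoinRoot.modByMonicHom cubic_monic r).coeff 1 +
      (AdjoinRoot.modByMonicHom cubic_monic r).coeff 2,
    (AdjoinRoot.modByMonicHom cubic_monic r).coeff 2]

/-- The support of a vector in `Z₂^m`. -/
def supp {m : ℕ} (v : Fin m → ZMod 2) : Finset (Fin m) :=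
  Finset.univ.filter (fun i => v i = 1)

/-- The simplicial complex `Δ_X` generated by `X ⊆ [m]`. -/
def Δ {m : ℕ} (X : Finset (Fin m)) : Finset (Fin m → ZMod 2) :=
  Finset.univ.filter (fun v => supp v ⊆ X)

/-- The Lee weight of a tuple over `R`: the Hamming weight of its coordinatewise Gray image. -/
def wtL {ι : Type} [Fintype ι] (x : ι → Rng) : ℕ :=
  ∑ i, (Finset.univ.filter (fun j : Fin 3 => Phi (x i) j ≠ 0)).card

/-- The defining set `D = (1+u²)D₁ + u²(D₂ + (u+u²)D₃) ⊆ R^m`. -/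
def Dset {m : ℕ} (D1 D2 D3 : Finset (Fin m → ZMod 2)) : Finset (Fin m → Rng) :=
  ((D1 ×ˢ D2) ×ˢ D3).image (fun t i =>
    (1 + u ^ 2) * toRng (t.1.1 i) +
      u ^ 2 * (toRng (t.1.2 i) + (u + u ^ 2) * toRng (t.2 i)))

/-- The codeword `c_D(v) = (v ⬝ d)_{d ∈ D}` of `C_D`. -/
def cD {m : ℕ} (D : Finset (Fin m → Rng)) (v : Fin m → Rng) : D → Rng :=
  fun d => ∑ i, v i * d.1 i


lemma supp_inter_eq {m : ℕ} (v : Fin m → ZMod 2) (L : Finset (Fin m)) :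
    supp v ∩ L = ∅ ↔ ∀ i ∈ L, v i = 0 := by
  have key : ∀ a : ZMod 2, a = 0 ↔ ¬ a = 1 := by decide
  simp only [Finset.eq_empty_iff_forall_notMem, supp, Finset.mem_inter, Finset.mem_filter,
    Finset.mem_univ, true_and, key]
  exact ⟨fun h i hi h1 => h i ⟨h1, hi⟩, fun h i hi => h i hi.2 hi.1⟩

lemma card_vanish {m : ℕ} (L : Finset (Fin m)) :
    (Finset.univ.filter (fun v : Fin m → ZMod 2 => ∀ i ∈ L, v i = 0)).card
      = 2 ^ (m - L.card) := by
  have h : Finset.univ.filter (fun v : Fin m → ZMod 2 => ∀ i ∈ L, v i = 0)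
      = Fintype.piFinset (fun i => if i ∈ L then ({0} : Finset (ZMod 2)) else Finset.univ) := by
    ext v
    simp only [Finset.mem_filter, Finset.mem_univ, true_and, Fintype.mem_piFinset]
    refine forall_congr' fun i => ?_
    by_cases hi : i ∈ L <;> simp [hi]
  rw [h, Fintype.card_piFinset]
  have h2 : ∀ i, (if i ∈ L then ({0} : Finset (ZMod 2)) else Finset.univ).card
      = if i ∈ Lᶜ then 2 else 1 := by
    intro i
    by_cases hi : i ∈ L <;> simp [hi, ZMod.card]
  simp only [h2]
  rw [Finset.prod_ite_mem, Finset.univ_inter, Finset.prod_const, Finset.card_compl,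
    Fintype.card_fin]

lemma card_vanish_shift {m : ℕ} (v : Fin m → ZMod 2) (L : Finset (Fin m)) :
    (Finset.univ.filter (fun w : Fin m → ZMod 2 => ∀ i ∈ L, (v + w) i = 0)).card
      = 2 ^ (m - L.card) := by
  rw [← card_vanish L]
  refine Finset.card_bij (fun w _ => v + w) ?_ ?_ ?_
  · intro w hw
    simpa using hw
  · intro a _ b _ hab
    exact add_left_cancel hab
  · intro b hb
    refine ⟨b - v, ?_, by simp⟩
    simpa using hb

/-- Inclusion-exclusion for the complement of two predicates. -/
lemma card_neither {α : Type*} [Fintype α] (P Q : α → Prop)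
    [DecidablePred P] [DecidablePred Q] :
    ((Finset.univ.filter (fun a => ¬ P a ∧ ¬ Q a)).card : ℤ)
      = Fintype.card α - (Finset.univ.filter P).card - (Finset.univ.filter Q).card
        + (Finset.univ.filter (fun a => P a ∧ Q a)).card := by
  have h1 := Finset.card_union_add_card_inter (Finset.univ.filter P) (Finset.univ.filter Q)
  rw [← Finset.filter_or, ← Finset.filter_and] at h1
  have h2 := Finset.card_filter_add_card_filter_not (s := (Finset.univ : Finset α))
    (fun a => P a ∨ Q a)
  simp only [not_or, Finset.card_univ] at h2
  omega

theorem count_pairs_chi_zero (m : ℕ) (hm : 0 < m) (M N : Finset (Fin m)) :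
    ((Finset.univ.filter (fun p : (Fin m → ZMod 2) × (Fin m → ZMod 2) =>
        supp p.1 ∩ M ≠ ∅ ∧ supp p.1 ∩ N ≠ ∅ ∧ supp p.2 ∩ M ≠ ∅ ∧
          supp (p.1 + p.2) ∩ M ≠ ∅)).card : ℤ) =
      ((2 ^ M.card - 1) * 2 ^ (m - M.card) + (2 ^ N.card - 1) * 2 ^ (m - N.card)
          - (2 ^ (M ∪ N).card - 1) * 2 ^ (m - (M ∪ N).card)) *
        ((2 ^ M.card - 2) * 2 ^ (m - M.card)) := by
  have hle : ∀ L : Finset (Fin m), L.card ≤ m := fun L => by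
    simpa using Finset.card_le_univ L
  have hpow : ∀ L : Finset (Fin m), (2 : ℤ) ^ L.card * 2 ^ (m - L.card) = 2 ^ m := fun L => by
    rw [← pow_add, Nat.add_sub_cancel' (hle L)]
  have hcard : (Fintype.card (Fin m → ZMod 2) : ℤ) = 2 ^ m := by simp [ZMod.card]
  simp only [ne_eq, supp_inter_eq]
  -- the number of admissible `w` for a fixed `v`
  have hw : ∀ v : Fin m → ZMod 2, ¬ (∀ i ∈ M, v i = 0) →
      ((Finset.univ.filter (fun w : Fin m → ZMod 2 =>
        ¬ (∀ i ∈ M, w i = 0) ∧ ¬ (∀ i ∈ M, (v + w) i = 0))).card : ℤ)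
        = (2 ^ M.card - 2) * 2 ^ (m - M.card) := by
    intro v hv
    rw [card_neither, card_vanish, card_vanish_shift, hcard]
    have h0 : (Finset.univ.filter (fun w : Fin m → ZMod 2 =>
        (∀ i ∈ M, w i = 0) ∧ (∀ i ∈ M, (v + w) i = 0))) = ∅ := by
      rw [Finset.filter_eq_empty_iff]
      rintro w - ⟨h1, h2⟩
      refine hv fun i hi => ?_
      have := h2 i hi
      simpa [h1 i hi] using this
    rw [h0, Finset.card_empty]
    have := hpow M
    push_cast
    linear_combination -this
  -- the number of admissible `v`
  have hv : ((Finset.univ.filter (fun v : Fin m → ZMod 2 =>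
        ¬ (∀ i ∈ M, v i = 0) ∧ ¬ (∀ i ∈ N, v i = 0))).card : ℤ)
      = (2 ^ M.card - 1) * 2 ^ (m - M.card) + (2 ^ N.card - 1) * 2 ^ (m - N.card)
          - (2 ^ (M ∪ N).card - 1) * 2 ^ (m - (M ∪ N).card) := by
    rw [card_neither, card_vanish, card_vanish, hcard]
    have h0 : (Finset.univ.filter (fun v : Fin m → ZMod 2 =>
        (∀ i ∈ M, v i = 0) ∧ (∀ i ∈ N, v i = 0)))
        = Finset.univ.filter (fun v : Fin m → ZMod 2 => ∀ i ∈ M ∪ N, v i = 0) := by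
      ext v
      simp only [Finset.mem_filter, Finset.mem_univ, true_and, Finset.mem_union, or_imp,
        forall_and]
    rw [h0, card_vanish]
    have h1 := hpow M
    have h2 := hpow N
    have h3 := hpow (M ∪ N)
    push_cast
    linear_combination -h1 - h2 + h3
  rw [← hv, Finset.card_filter, Fintype.sum_prod_type, Finset.card_filter]
  push_cast
  rw [Finset.sum_mul]
  refine Finset.sum_congr rfl fun v _ => ?_
  by_cases hM : ∀ i ∈ M, v i = 0
  · rw [if_neg (fun h => h.1 hM), zero_mul]
    exact Finset.sum_eq_zero fun w _ => if_neg (fun h => h.1 hM)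
  by_cases hN : ∀ i ∈ N, v i = 0
  · rw [if_neg (fun h => h.2 hN), zero_mul]
    exact Finset.sum_eq_zero fun w _ => if_neg (fun h => h.2.1 hN)
  rw [← hw v hM, if_pos ⟨hM, hN⟩, one_mul, Finset.card_filter]
  push_cast
  refine Finset.sum_congr rfl fun w _ => ?_
  simp only [hM, hN, not_false_eq_true, true_and]

end
end

section
/- Let m be a positive integer and L, M, N ⊆ [m] with |L|+|M|+|N| ≥ 1. Let D = (1+u^2)Δ_L + u^2(Δ_M + (u+u^2)Δ_N) ⊆ R^m. Then C_D has length |D| = 2^{|L|+|M|+|N|} and |C_D| = 2^{|L|+|M|+|M∪N|}. Moreover, writing s = |L|+|M|+|N|, for every v ∈ R^m the Lee weight wt_L(c_D(v)) is 0, 2^s, or 3·2^{s−1}; the number of v ∈ R^m with wt_L(c_D(v)) = 3·2^{s−1} is 2^{3m} + 2^{3m−|L|−|M|−|M∪N|+1} − 2^{3m−|L|−|M|} − 2^{3m−|L|−|M|−|N|+1}; the number with wt_L(c_D(v)) = 2^s is 2^{3m−|L|−|M|} + 2^{3m−|L|−|M|−|N|+1} − 3·2^{3m−|L|−|M|−|M∪N|};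 and the number with wt_L(c_D(v)) = 0 is 2^{3m−|L|−|M|−|M∪N|}. -/
open Polynomial
open scoped Classical

noncomputable section

section helpers

def mkR (A B C : ZMod 2) : Rng :=
  (1 + u ^ 2) * toRng A + u ^ 2 * (toRng B + (u + u ^ 2) * toRng C)

lemma u_cubed : u ^ 3 = u := by
  have h : AdjoinRoot.mk (X ^ 3 - X : Polynomial (ZMod 2)) (X ^ 3 - X) = 0 := AdjoinRoot.mk_self
  rw [map_sub, map_pow, AdjoinRoot.mk_X] at h
  exact sub_eq_zero.mp h

lemma two_R : (2 : Rng) = 0 := by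
  have : toRng (2 : ZMod 2) = 0 := by
    rw [show (2 : ZMod 2) = 0 from rfl, map_zero]
  rw [← this, map_ofNat]

lemma mkR_eq (A B C : ZMod 2) :
    mkR A B C = AdjoinRoot.mk (X ^ 3 - X : Polynomial (ZMod 2))
      (Polynomial.C A + Polynomial.C C * X + Polynomial.C (A + B + C) * X ^ 2) := by
  simp only [map_add, map_mul, map_pow, AdjoinRoot.mk_X, AdjoinRoot.mk_C]
  change mkR A B C = toRng A + toRng C * u + (toRng A + toRng B + toRng C) * u ^ 2
  unfold mkR
  linear_combination (toRng C + u * toRng C) * u_cubed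

lemma coeff_mkR (A B C : ZMod 2) :
    AdjoinRoot.modByMonicHom cubic_monic (mkR A B C) =
      (Polynomial.C A + Polynomial.C C * X + Polynomial.C (A + B + C) * X ^ 2) := by
  rw [mkR_eq, AdjoinRoot.modByMonicHom_mk]
  rw [Polynomial.modByMonic_eq_self_iff cubic_monic]
  have h3 : (X ^ 3 - X : Polynomial (ZMod 2)).degree = 3 := by
    compute_degree!
  rw [h3]
  refine lt_of_le_of_lt (b := 2) ?_ (by norm_num)
  compute_degree!

lemma Phi_mkR (A B C : ZMod 2) : Phi (mkR A B C) = ![A + C, A + B, A + B + C] := by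
  unfold Phi
  rw [coeff_mkR]
  have e : C + (A + B + C) = A + B := by
    revert A B C; decide
  generalize hE : A + B + C = E at *
  simp [Polynomial.coeff_X, Polynomial.coeff_C, Polynomial.coeff_X_pow, e]

lemma mkR_inj {A B C A' B' C' : ZMod 2} (h : mkR A B C = mkR A' B' C') :
    A = A' ∧ B = B' ∧ C = C' := by
  have h1 := congrArg Phi h
  rw [Phi_mkR, Phi_mkR] at h1
  have a0 := congrFun h1 0
  have a1 := congrFun h1 1
  have a2 := congrFun h1 2
  simp at a0 a1 a2
  clear h h1
  revert A B C A' B' C'; decide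

lemma mkR_surj (r : Rng) : ∃ A B C, r = mkR A B C := by
  obtain ⟨p, rfl⟩ := AdjoinRoot.mk_surjective r
  have h3 : (X ^ 3 - X : Polynomial (ZMod 2)).degree = 3 := by
    compute_degree!
  have hd : (p %ₘ (X ^ 3 - X)).degree < 3 := h3 ▸ Polynomial.degree_modByMonic_lt p cubic_monic
  have hp : AdjoinRoot.mk (X ^ 3 - X : Polynomial (ZMod 2)) p =
      AdjoinRoot.mk (X ^ 3 - X : Polynomial (ZMod 2)) (p %ₘ (X ^ 3 - X)) := by
    conv_lhs => rw [← Polynomial.modByMonic_add_div p (X ^ 3 - X)]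
    simp
  generalize p %ₘ (X ^ 3 - X) = q at hd hp
  refine ⟨q.coeff 0, q.coeff 0 + q.coeff 1 + q.coeff 2, q.coeff 1, ?_⟩
  rw [hp, mkR_eq]
  congr 1
  have hn : q.natDegree < 3 := by
    by_cases hq : q = 0
    · simp [hq]
    · exact (Polynomial.natDegree_lt_iff_degree_lt hq).2 hd
  have e : ∀ a b c : ZMod 2, a + (a + b + c) + b = c := by decide
  rw [e]
  conv_lhs => rw [q.as_sum_range_C_mul_X_pow' hn]
  simp [Finset.sum_range_succ]

lemma mkR_add (A B C A' B' C' : ZMod 2) :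
    mkR (A + A') (B + B') (C + C') = mkR A B C + mkR A' B' C' := by
  unfold mkR; simp only [map_add]; ring

lemma mkR_zero : mkR 0 0 0 = 0 := by simp [mkR]

lemma mkR_mul (A B C A' B' C' : ZMod 2) :
    mkR A B C * mkR A' B' C' = mkR (A * A') (B * B') (B * C' + C * B') := by
  have h4 : u ^ 4 = u ^ 2 := by linear_combination u * u_cubed
  have h5 : u ^ 5 = u := by linear_combination (u ^ 2 + 1) * u_cubed
  have h6 : u ^ 6 = u ^ 2 := by linear_combination (u ^ 3 + u) * u_cubed
  have hf (x y z : ZMod 2) : mkR x y z =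
      (1 + u ^ 2) * toRng x + u ^ 2 * toRng y + (u + u ^ 2) * toRng z := by
    unfold mkR
    linear_combination (toRng z + u * toRng z) * u_cubed
  rw [hf, hf, hf]
  simp only [map_add, map_mul]
  generalize toRng A = a
  generalize toRng B = b
  generalize toRng C = c
  generalize toRng A' = a'
  generalize toRng B' = b'
  generalize toRng C' = c'
  have he : (1 + u ^ 2) * (1 + u ^ 2) = 1 + u ^ 2 := by linear_combination h4 + u ^ 2 * two_R
  have hff : u ^ 2 * u ^ 2 = u ^ 2 := by linear_combination h4
  have hn : (u + u ^ 2) * (u + u ^ 2) = 0 := by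
    linear_combination h4 + 2 * u_cubed + (u ^ 2 + u) * two_R
  have hef : (1 + u ^ 2) * u ^ 2 = 0 := by linear_combination h4 + u ^ 2 * two_R
  have hen : (1 + u ^ 2) * (u + u ^ 2) = 0 := by
    linear_combination h4 + u_cubed + (u + u ^ 2) * two_R
  have hfn : u ^ 2 * (u + u ^ 2) = u + u ^ 2 := by linear_combination h4 + u_cubed
  generalize (1 + u ^ 2) = e at *
  generalize u + u ^ 2 = n at *
  generalize u ^ 2 = f at *
  linear_combination a * a' * he + b * b' * hff + c * c' * hn + (a * b' + b * a') * hef +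
    (a * c' + c * a') * hen + (b * c' + c * b') * hfn

abbrev Vec (m : ℕ) := Fin m → ZMod 2
abbrev Tri (m : ℕ) := (Vec m × Vec m) × Vec m

def mkV {m : ℕ} (t : Tri m) : Fin m → Rng := fun i => mkR (t.1.1 i) (t.1.2 i) (t.2 i)

lemma mkV_bij (m : ℕ) : Function.Bijective (mkV : Tri m → _) := by
  constructor
  · rintro ⟨⟨a, b⟩, c⟩ ⟨⟨a', b'⟩, c'⟩ h
    have h' := fun i => mkR_inj (congrFun h i)
    simp only [Prod.mk.injEq]
    exact ⟨⟨funext fun i => (h' i).1, funext fun i => (h' i).2.1⟩, funext fun i => (h' i).2.2⟩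
  · intro v
    choose a b c h using fun i => mkR_surj (v i)
    exact ⟨((a, b), c), funext fun i => (h i).symm⟩

def dotp {m : ℕ} (a b : Vec m) : ZMod 2 := ∑ i, a i * b i

lemma dotp_add {m : ℕ} (a b c : Vec m) : dotp a (b + c) = dotp a b + dotp a c := by
  simp [dotp, mul_add, Finset.sum_add_distrib]

lemma add_dotp {m : ℕ} (a b c : Vec m) : dotp (a + b) c = dotp a c + dotp b c := by
  simp [dotp, add_mul, Finset.sum_add_distrib]

lemma sum_mkR {ι : Type} (s : Finset ι) (f g h : ι → ZMod 2) :
    ∑ i ∈ s, mkR (f i) (g i) (h i) = mkR (∑ i ∈ s, f i) (∑ i ∈ s, g i) (∑ i ∈ s, h i) := by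
  induction s using Finset.induction_on with
  | empty => simp [mkR_zero]
  | insert a s ha ih => simp only [Finset.sum_insert ha, ih, mkR_add]

lemma mkV_dot {m : ℕ} (v t : Tri m) : ∑ i, mkV v i * mkV t i =
    mkR (dotp v.1.1 t.1.1) (dotp v.1.2 t.1.2) (dotp v.1.2 t.2 + dotp v.2 t.1.2) := by
  simp only [mkV, mkR_mul, sum_mkR, dotp, Finset.sum_add_distrib]

/-- vanishing on a set -/
def Zr {m : ℕ} (S : Finset (Fin m)) (a : Vec m) : Prop := ∀ i ∈ S, a i = 0

lemma card_Zr {m : ℕ} (S : Finset (Fin m)) :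
    (Finset.univ.filter (fun a : Vec m => Zr S a)).card = 2 ^ (m - S.card) := by
  have : Finset.univ.filter (fun a : Vec m => Zr S a) =
      Fintype.piFinset (fun i => if i ∈ S then ({0} : Finset (ZMod 2)) else Finset.univ) := by
    ext a
    simp only [Finset.mem_filter, Finset.mem_univ, true_and, Fintype.mem_piFinset]
    unfold Zr
    refine forall_congr' fun i => ?_
    by_cases h : i ∈ S <;> simp [h]
  rw [this, Fintype.card_piFinset]
  have h2 : ∀ i : Fin m, (if i ∈ S then ({0} : Finset (ZMod 2)) else Finset.univ).card =
      if i ∈ S then 1 else 2 := by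
    intro i; split_ifs <;> simp [ZMod.card]
  simp only [h2]
  rw [Finset.prod_ite]
  simp only [Finset.prod_const, one_pow, one_mul]
  congr 1
  have := Finset.card_compl S
  rw [Fintype.card_fin] at this
  rw [← this]
  congr 1
  ext; simp

lemma mem_Δ {m : ℕ} (S : Finset (Fin m)) (a : Vec m) : a ∈ Δ S ↔ Zr Sᶜ a := by
  unfold Δ
  rw [Finset.mem_filter]
  simp only [Finset.mem_univ, true_and]
  unfold supp Zr
  simp only [Finset.mem_compl]
  constructor
  · intro h i hi
    by_contra h0
    have : ∀ x : ZMod 2, x ≠ 0 → x = 1 := by decide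
    exact hi (h (by simp [this _ h0]))
  · intro h i hi
    by_contra h0
    simp [h i h0] at hi

lemma card_Δ {m : ℕ} (S : Finset (Fin m)) : (Δ S).card = 2 ^ S.card := by
  have : Δ S = Finset.univ.filter (fun a : Vec m => Zr Sᶜ a) := by
    ext a; simp [mem_Δ]
  rw [this, card_Zr, Finset.card_compl, Fintype.card_fin]
  congr 1
  have := Finset.card_le_univ S
  rw [Fintype.card_fin] at this
  omega

lemma dot_Δ {m : ℕ} (S : Finset (Fin m)) (a : Vec m) : (∀ t ∈ Δ S, dotp a t = 0) ↔ Zr S a := by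
  constructor
  · intro h i hi
    have := h (Pi.single i 1) (by
      rw [mem_Δ]; intro j hj
      have : j ≠ i := by rintro rfl; simp [hi] at hj
      simp [this])
    simpa [dotp, Pi.single_apply] using this
  · intro h t ht
    rw [mem_Δ] at ht
    refine Finset.sum_eq_zero fun i _ => ?_
    by_cases hi : i ∈ S
    · simp [h i hi]
    · simp [ht i (by simpa using hi)]

lemma zero_Δ {m : ℕ} (S : Finset (Fin m)) : (0 : Vec m) ∈ Δ S := by
  rw [mem_Δ]; intro i _; rfl

lemma add_Δ {m : ℕ} {S : Finset (Fin m)} {a b : Vec m} (ha : a ∈ Δ S) (hb : b ∈ Δ S) :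
    a + b ∈ Δ S := by
  rw [mem_Δ] at *; intro i hi; simp [ha i hi, hb i hi]

abbrev TT {m : ℕ} (L M N : Finset (Fin m)) : Finset (Tri m) := (Δ L ×ˢ Δ M) ×ˢ Δ N

/-- the character -/
def chi {m : ℕ} (w t : Tri m) : ZMod 2 := dotp w.1.1 t.1.1 + dotp w.1.2 t.1.2 + dotp w.2 t.2

lemma chi_add {m : ℕ} (w t s : Tri m) : chi w (t + s) = chi w t + chi w s := by
  simp only [chi, Prod.fst_add, Prod.snd_add, dotp_add]; ring

lemma dotp_zero {m : ℕ} (a : Vec m) : dotp a 0 = 0 := by simp [dotp]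

lemma chi_zero_iff {m : ℕ} (L M N : Finset (Fin m)) (w : Tri m) :
    (∀ t ∈ TT L M N, chi w t = 0) ↔ Zr L w.1.1 ∧ Zr M w.1.2 ∧ Zr N w.2 := by
  rw [← dot_Δ, ← dot_Δ, ← dot_Δ]
  constructor
  · intro h
    refine ⟨fun t ht => ?_, fun t ht => ?_, fun t ht => ?_⟩
    · simpa [chi, dotp_zero] using h ((t, 0), 0) (by simp [ht, zero_Δ])
    · simpa [chi, dotp_zero] using h ((0, t), 0) (by simp [ht, zero_Δ])
    · simpa [chi, dotp_zero] using h ((0, 0), t) (by simp [ht, zero_Δ])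
  · rintro ⟨h1, h2, h3⟩ t ht
    simp only [TT, Finset.mem_product] at ht
    simp [chi, h1 _ ht.1.1, h2 _ ht.1.2, h3 _ ht.2]

lemma card_TT {m : ℕ} (L M N : Finset (Fin m)) :
    (TT L M N).card = 2 ^ (L.card + M.card + N.card) := by
  simp [TT, card_Δ, pow_add]

lemma card_chi {m : ℕ} (L M N : Finset (Fin m)) (hs : 1 ≤ L.card + M.card + N.card) (w : Tri m) :
    ((TT L M N).filter (fun t => chi w t ≠ 0)).card =
      if Zr L w.1.1 ∧ Zr M w.1.2 ∧ Zr N w.2 then 0 else 2 ^ (L.card + M.card + N.card - 1) := by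
  split_ifs with h
  · rw [← chi_zero_iff] at h
    rw [Finset.card_eq_zero, Finset.filter_eq_empty_iff]
    intro t ht; simp [h t ht]
  · rw [← chi_zero_iff] at h
    push Not at h
    obtain ⟨t0, ht0, hc⟩ := h
    have hz : ∀ x y : ZMod 2, x ≠ 0 → y ≠ 0 → x + y = 0 := by decide
    have hmem : ∀ t ∈ TT L M N, t + t0 ∈ TT L M N := by
      intro t ht
      simp only [TT, Finset.mem_product] at ht ht0 ⊢
      exact ⟨⟨add_Δ ht.1.1 ht0.1.1, add_Δ ht.1.2 ht0.1.2⟩, add_Δ ht.2 ht0.2⟩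
    have hinv : t0 + t0 = 0 := by
      have hv : ∀ a : Vec m, a + a = 0 := fun a => funext fun i => CharTwo.add_self_eq_zero (a i)
      exact Prod.ext (Prod.ext (hv _) (hv _)) (hv _)
    have hb : ((TT L M N).filter (fun t => chi w t ≠ 0)).card =
        ((TT L M N).filter (fun t => ¬ chi w t ≠ 0)).card := by
      refine Finset.card_bij' (fun t _ => t + t0) (fun t _ => t + t0) ?_ ?_ ?_ ?_
      · intro t ht
        simp only [Finset.mem_filter] at ht ⊢
        exact ⟨hmem t ht.1, by rw [chi_add, hz _ _ ht.2 hc]; simp⟩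
      · intro t ht
        simp only [Finset.mem_filter, not_not] at ht ⊢
        exact ⟨hmem t ht.1, by rw [chi_add, ht.2, zero_add]; exact hc⟩
      · intro t _; simp only [add_assoc, hinv, add_zero]
      · intro t _; simp only [add_assoc, hinv, add_zero]
    have htot := Finset.card_filter_add_card_filter_not (s := TT L M N) (fun t => chi w t ≠ 0)
    rw [← hb, card_TT] at htot
    obtain ⟨k, hk⟩ : ∃ k, L.card + M.card + N.card = k + 1 := ⟨_, (Nat.sub_add_cancel hs).symm⟩
    rw [hk, pow_succ] at htot
    rw [hk, Nat.add_sub_cancel]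
    omega

lemma Dset_eq {m : ℕ} (L M N : Finset (Fin m)) :
    Dset (Δ L) (Δ M) (Δ N) = (TT L M N).image mkV := rfl

lemma wt_eq {m : ℕ} (L M N : Finset (Fin m)) (v : Tri m) :
    wtL (cD (Dset (Δ L) (Δ M) (Δ N)) (mkV v)) =
      ((TT L M N).filter (fun t => chi ((v.1.1, v.2), v.1.2) t ≠ 0)).card +
      ((TT L M N).filter (fun t => chi ((v.1.1, v.1.2), 0) t ≠ 0)).card +
      ((TT L M N).filter (fun t => chi ((v.1.1, v.1.2 + v.2), v.1.2) t ≠ 0)).card := by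
  have h1 : wtL (cD (Dset (Δ L) (Δ M) (Δ N)) (mkV v)) = ∑ t ∈ TT L M N,
      (Finset.univ.filter (fun j : Fin 3 => Phi (∑ i, mkV v i * mkV t i) j ≠ 0)).card := by
    unfold wtL cD
    rw [Finset.sum_coe_sort (Dset (Δ L) (Δ M) (Δ N)) (fun d =>
      (Finset.univ.filter (fun j : Fin 3 => Phi (∑ i, mkV v i * d i) j ≠ 0)).card)]
    rw [Dset_eq, Finset.sum_image (fun a _ b _ h => (mkV_bij m).1 h)]
  rw [h1]
  simp only [Finset.card_filter, ← Finset.sum_add_distrib]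
  refine Finset.sum_congr rfl fun t _ => ?_
  rw [mkV_dot, Phi_mkR, Fin.sum_univ_three]
  have e1 : dotp v.1.1 t.1.1 + (dotp v.1.2 t.2 + dotp v.2 t.1.2) =
    chi ((v.1.1, v.2), v.1.2) t := by simp only [chi]; ring
  have e2 : dotp v.1.1 t.1.1 + dotp v.1.2 t.1.2 =
    chi ((v.1.1, v.1.2), 0) t := by simp [chi, dotp]
  have e3 : dotp v.1.1 t.1.1 + dotp v.1.2 t.1.2 + (dotp v.1.2 t.2 + dotp v.2 t.1.2) =
    chi ((v.1.1, v.1.2 + v.2), v.1.2) t := by simp only [chi, add_dotp]; ring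
  rw [← e1, ← e2, ← e3]
  rfl

def P1 {m : ℕ} (L M N : Finset (Fin m)) (v : Tri m) : Prop := Zr L v.1.1 ∧ Zr N v.1.2 ∧ Zr M v.2
def P2 {m : ℕ} (L M : Finset (Fin m)) (v : Tri m) : Prop := Zr L v.1.1 ∧ Zr M v.1.2 ∧ Zr ∅ v.2
def P3 {m : ℕ} (L M N : Finset (Fin m)) (v : Tri m) : Prop :=
  Zr L v.1.1 ∧ Zr N v.1.2 ∧ Zr M (v.1.2 + v.2)
def P0 {m : ℕ} (L M N : Finset (Fin m)) (v : Tri m) : Prop :=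
  Zr L v.1.1 ∧ Zr (M ∪ N) v.1.2 ∧ Zr M v.2

lemma wt_eq' {m : ℕ} (L M N : Finset (Fin m)) (hs : 1 ≤ L.card + M.card + N.card) (v : Tri m) :
    wtL (cD (Dset (Δ L) (Δ M) (Δ N)) (mkV v)) =
      (if P1 L M N v then 0 else 2 ^ (L.card + M.card + N.card - 1)) +
      (if P2 L M v then 0 else 2 ^ (L.card + M.card + N.card - 1)) +
      (if P3 L M N v then 0 else 2 ^ (L.card + M.card + N.card - 1)) := by
  rw [wt_eq, card_chi _ _ _ hs, card_chi _ _ _ hs, card_chi _ _ _ hs]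
  have a1 : (Zr L v.1.1 ∧ Zr M v.2 ∧ Zr N v.1.2) ↔ P1 L M N v := by unfold P1; tauto
  have a2 : (Zr L v.1.1 ∧ Zr M v.1.2 ∧ Zr N 0) ↔ P2 L M v := by
    have : Zr N (0 : Vec m) := fun _ _ => rfl
    have : Zr ∅ v.2 := fun i hi => by simp at hi
    unfold P2; tauto
  have a3 : (Zr L v.1.1 ∧ Zr M (v.1.2 + v.2) ∧ Zr N v.1.2) ↔ P3 L M N v := by unfold P3; tauto
  simp only [a1, a2, a3]

lemma Zr_union {m : ℕ} (M N : Finset (Fin m)) (b : Vec m) : Zr (M ∪ N) b ↔ Zr M b ∧ Zr N b := by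
  simp only [Zr, Finset.mem_union]
  constructor
  · exact fun h => ⟨fun i hi => h i (Or.inl hi), fun i hi => h i (Or.inr hi)⟩
  · rintro ⟨h1, h2⟩ i (hi | hi)
    exacts [h1 i hi, h2 i hi]

lemma P_rel {m : ℕ} (L M N : Finset (Fin m)) (v : Tri m) :
    ((P1 L M N v ∧ P2 L M v) ↔ P0 L M N v) ∧ ((P1 L M N v ∧ P3 L M N v) ↔ P0 L M N v) ∧
    ((P2 L M v ∧ P3 L M N v) ↔ P0 L M N v) := by
  have h0 : Zr ∅ v.2 := fun i hi => by simp at hi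
  have e1 : Zr M v.1.2 → Zr M v.2 → Zr M (v.1.2 + v.2) := fun h1 h2 i hi => by
    simp [h1 i hi, h2 i hi]
  have e2 : Zr M v.1.2 → Zr M (v.1.2 + v.2) → Zr M v.2 := fun h1 h2 i hi => by
    have := h2 i hi
    simpa [h1 i hi] using this
  have e3 : Zr M v.2 → Zr M (v.1.2 + v.2) → Zr M v.1.2 := fun h1 h2 i hi => by
    have := h2 i hi
    simpa [h1 i hi] using this
  unfold P0 P1 P2 P3
  rw [Zr_union]
  tauto

lemma P_cases {m : ℕ} (L M N : Finset (Fin m)) (v : Tri m) :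
    (P1 L M N v ∧ P2 L M v ∧ P3 L M N v ∧ P0 L M N v) ∨
    (P1 L M N v ∧ ¬ P2 L M v ∧ ¬ P3 L M N v ∧ ¬ P0 L M N v) ∨
    (¬ P1 L M N v ∧ P2 L M v ∧ ¬ P3 L M N v ∧ ¬ P0 L M N v) ∨
    (¬ P1 L M N v ∧ ¬ P2 L M v ∧ P3 L M N v ∧ ¬ P0 L M N v) ∨
    (¬ P1 L M N v ∧ ¬ P2 L M v ∧ ¬ P3 L M N v ∧ ¬ P0 L M N v) := by
  obtain ⟨r1, r2, r3⟩ := P_rel L M N v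
  generalize P1 L M N v = p1 at *
  generalize P2 L M v = p2 at *
  generalize P3 L M N v = p3 at *
  generalize P0 L M N v = p0 at *
  tauto

lemma card_box {m : ℕ} (A B C : Finset (Fin m)) (P : Tri m → Prop) [DecidablePred P]
    (hP : ∀ v, P v ↔ Zr A v.1.1 ∧ Zr B v.1.2 ∧ Zr C v.2) :
    (Finset.univ.filter P).card = 2 ^ (3 * m - A.card - B.card - C.card) := by
  have : Finset.univ.filter P =
    (Finset.univ.filter (fun a : Vec m => Zr A a) ×ˢ Finset.univ.filter (fun a : Vec m => Zr B a))
      ×ˢ Finset.univ.filter (fun a : Vec m => Zr C a) := by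
    ext v; simp [and_assoc, hP]
  rw [this, Finset.card_product, Finset.card_product, card_Zr, card_Zr, card_Zr, ← pow_add,
    ← pow_add]
  congr 1
  have hA := Finset.card_le_univ A
  have hB := Finset.card_le_univ B
  have hC := Finset.card_le_univ C
  rw [Fintype.card_fin] at hA hB hC
  omega

lemma card_P3 {m : ℕ} (L M N : Finset (Fin m)) :
    (Finset.univ.filter (fun v : Tri m => P3 L M N v)).card =
    (Finset.univ.filter (fun v : Tri m => P1 L M N v)).card := by
  have hv : ∀ a b : Vec m, a + (a + b) = b := fun a b => by
    rw [← add_assoc, show a + a = 0 from funext fun i => CharTwo.add_self_eq_zero (a i), zero_add]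
  refine Finset.card_bij' (fun v _ => (v.1, v.1.2 + v.2)) (fun v _ => (v.1, v.1.2 + v.2)) ?_ ?_ ?_ ?_
  · intro v hv'
    rw [Finset.mem_filter] at hv' ⊢
    exact ⟨Finset.mem_univ _, hv'.2⟩
  · intro v hv'
    rw [Finset.mem_filter] at hv' ⊢
    refine ⟨Finset.mem_univ _, hv'.2.1, hv'.2.2.1, ?_⟩
    simpa only [hv] using hv'.2.2.2
  · intro v _; simp [hv]
  · intro v _; simp [hv]

lemma natcard_eq {m : ℕ} (Q : (Fin m → Rng) → Prop)
    [DecidablePred fun v : Tri m => Q (mkV v)] :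
    Nat.card {v : Fin m → Rng | Q v} =
      (Finset.univ.filter (fun v : Tri m => Q (mkV v))).card := by
  have e : {v : Tri m // Q (mkV v)} ≃ {v : Fin m → Rng // Q v} :=
    (Equiv.ofBijective mkV (mkV_bij m)).subtypeEquiv (fun a => Iff.rfl)
  have := Nat.card_congr e
  rw [Nat.card_eq_fintype_card, Fintype.card_subtype] at this
  exact this.symm

lemma card_Vec3 (m : ℕ) : Nat.card (Fin m → Rng) = 2 ^ (3 * m) := by
  rw [← Nat.card_congr (Equiv.ofBijective mkV (mkV_bij m))]
  simp [ZMod.card]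
  ring

def cDhom {m : ℕ} (D : Finset (Fin m → Rng)) : (Fin m → Rng) →+ (D → Rng) where
  toFun := cD D
  map_zero' := by ext d; simp [cD]
  map_add' x y := by ext d; simp [cD, add_mul, Finset.sum_add_distrib]

lemma wtL_zero {ι : Type} [Fintype ι] (x : ι → Rng) : wtL x = 0 ↔ x = 0 := by
  unfold wtL
  rw [Finset.sum_eq_zero_iff]
  constructor
  · intro h
    funext i
    have h1 := h i (Finset.mem_univ i)
    rw [Finset.card_eq_zero, Finset.filter_eq_empty_iff] at h1
    obtain ⟨A, B, C, hr⟩ := mkR_surj (x i)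
    rw [hr, Phi_mkR] at h1
    have a0 := h1 (Finset.mem_univ 0)
    have a1 := h1 (Finset.mem_univ 1)
    have a2 := h1 (Finset.mem_univ 2)
    simp at a0 a1 a2
    have : A = 0 ∧ B = 0 ∧ C = 0 := by
      clear hr h1 h; revert A B C; decide
    rw [hr, this.1, this.2.1, this.2.2, mkR_zero]; rfl
  · rintro rfl i _
    have : Phi (0 : Rng) = ![0, 0, 0] := by
      rw [← mkR_zero, Phi_mkR]; simp
    rw [Finset.card_eq_zero, Finset.filter_eq_empty_iff]
    intro j _
    rw [Pi.zero_apply, this]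
    fin_cases j <;> simp

lemma card_range_mul {m : ℕ} (D : Finset (Fin m → Rng)) :
    Nat.card (Set.range (cD D)) * Nat.card {v : Fin m → Rng | wtL (cD D v) = 0} = 2 ^ (3 * m) := by
  have h1 := AddSubgroup.card_eq_card_quotient_mul_card_addSubgroup (cDhom D).ker
  rw [card_Vec3, Nat.card_congr (QuotientAddGroup.quotientKerEquivRange (cDhom D)).toEquiv] at h1
  rw [h1]
  congr 1
  refine Nat.card_congr (Equiv.subtypeEquivRight fun v => ?_)
  rw [AddMonoidHom.mem_ker]
  exact wtL_zero _

end helpers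

theorem lee_weight_distribution_LMN (m : ℕ) (hm : 0 < m) (L M N : Finset (Fin m))
    (hs : 1 ≤ L.card + M.card + N.card)
    (D : Finset (Fin m → Rng)) (hD : D = Dset (Δ L) (Δ M) (Δ N)) :
    D.card = 2 ^ (L.card + M.card + N.card) ∧
    Nat.card (Set.range (cD D)) = 2 ^ (L.card + M.card + (M ∪ N).card) ∧
    (∀ v : Fin m → Rng,
      wtL (cD D v) = 0 ∨
      wtL (cD D v) = 2 ^ (L.card + M.card + N.card) ∨
      wtL (cD D v) = 3 * 2 ^ (L.card + M.card + N.card - 1)) ∧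
    ((Nat.card {v : Fin m → Rng |
        wtL (cD D v) = 3 * 2 ^ (L.card + M.card + N.card - 1)} : ℤ) =
      2 ^ (3 * m) + 2 ^ (3 * m - L.card - M.card - (M ∪ N).card + 1)
        - 2 ^ (3 * m - L.card - M.card) - 2 ^ (3 * m - L.card - M.card - N.card + 1)) ∧
    ((Nat.card {v : Fin m → Rng |
        wtL (cD D v) = 2 ^ (L.card + M.card + N.card)} : ℤ) =
      2 ^ (3 * m - L.card - M.card) + 2 ^ (3 * m - L.card - M.card - N.card + 1)
        - 3 * 2 ^ (3 * m - L.card - M.card - (M ∪ N).card)) ∧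
    ((Nat.card {v : Fin m → Rng | wtL (cD D v) = 0} : ℤ) =
      2 ^ (3 * m - L.card - M.card - (M ∪ N).card)) := by
  subst hD
  have hpos : 0 < 2 ^ (L.card + M.card + N.card - 1) := by positivity
  have hss : 2 ^ (L.card + M.card + N.card) = 2 * 2 ^ (L.card + M.card + N.card - 1) := by
    rw [← pow_succ', Nat.sub_add_cancel hs]
  have hw := wt_eq' L M N hs
  have hL := Finset.card_le_univ L
  have hM := Finset.card_le_univ M
  have hN := Finset.card_le_univ N
  have hMN := Finset.card_le_univ (M ∪ N)
  rw [Fintype.card_fin] at hL hM hN hMN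
  have c0 : (Finset.univ.filter (fun v : Tri m => P0 L M N v)).card =
      2 ^ (3 * m - L.card - M.card - (M ∪ N).card) := by
    rw [card_box L (M ∪ N) M (fun v => P0 L M N v) (fun v => Iff.rfl)]; congr 1; omega
  have c1 : (Finset.univ.filter (fun v : Tri m => P1 L M N v)).card =
      2 ^ (3 * m - L.card - M.card - N.card) := by
    rw [card_box L N M (fun v => P1 L M N v) (fun v => Iff.rfl)]; congr 1; omega
  have c2 : (Finset.univ.filter (fun v : Tri m => P2 L M v)).card =
      2 ^ (3 * m - L.card - M.card) := by
    rw [card_box L M ∅ (fun v => P2 L M v) (fun v => Iff.rfl)]; simp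
  have c3 := (card_P3 L M N).trans c1
  have ct : (Finset.univ : Finset (Tri m)).card = 2 ^ (3 * m) := by
    simp [ZMod.card]; ring
  have k0 : Nat.card {v : Fin m → Rng | wtL (cD (Dset (Δ L) (Δ M) (Δ N)) v) = 0} =
      2 ^ (3 * m - L.card - M.card - (M ∪ N).card) := by
    rw [natcard_eq (fun v => wtL (cD (Dset (Δ L) (Δ M) (Δ N)) v) = 0), ← c0]
    congr 1
    refine Finset.filter_congr fun v _ => ?_
    rw [hw]
    generalize 2 ^ (L.card + M.card + N.card - 1) = q at *
    rcases P_cases L M N v with ⟨p1, p2, p3, p0⟩ | ⟨p1, p2, p3, p0⟩ | ⟨p1, p2, p3, p0⟩ |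
      ⟨p1, p2, p3, p0⟩ | ⟨p1, p2, p3, p0⟩ <;>
      simp [p1, p2, p3, p0, hpos.ne']
  refine ⟨?_, ?_, ?_, ?_, ?_, ?_⟩
  · rw [Dset_eq, Finset.card_image_of_injective _ (mkV_bij m).1, card_TT]
  · have h := card_range_mul (Dset (Δ L) (Δ M) (Δ N))
    rw [k0] at h
    have h2 : 2 ^ (L.card + M.card + (M ∪ N).card) *
        2 ^ (3 * m - L.card - M.card - (M ∪ N).card) = 2 ^ (3 * m) := by
      rw [← pow_add]; congr 1; omega
    exact Nat.eq_of_mul_eq_mul_right (by positivity) (h.trans h2.symm)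
  · intro v
    obtain ⟨v, rfl⟩ := (mkV_bij m).2 v
    rw [hw, hss]
    generalize 2 ^ (L.card + M.card + N.card - 1) = q at *
    rcases P_cases L M N v with ⟨p1, p2, p3, p0⟩ | ⟨p1, p2, p3, p0⟩ | ⟨p1, p2, p3, p0⟩ |
      ⟨p1, p2, p3, p0⟩ | ⟨p1, p2, p3, p0⟩ <;>
      simp only [p1, p2, p3, if_true, if_false, true_or] <;> omega
  · rw [natcard_eq (fun v => wtL (cD (Dset (Δ L) (Δ M) (Δ N)) v) =
      3 * 2 ^ (L.card + M.card + N.card - 1))]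
    have key : ((Finset.univ.filter (fun v : Tri m => wtL (cD (Dset (Δ L) (Δ M) (Δ N)) (mkV v)) =
      3 * 2 ^ (L.card + M.card + N.card - 1))).card : ℤ) =
      (Finset.univ : Finset (Tri m)).card
      - (Finset.univ.filter (fun v : Tri m => P1 L M N v)).card
      - (Finset.univ.filter (fun v : Tri m => P2 L M v)).card
      - (Finset.univ.filter (fun v : Tri m => P3 L M N v)).card
      + 2 * (Finset.univ.filter (fun v : Tri m => P0 L M N v)).card := by
      rw [Finset.card_eq_sum_ones (Finset.univ : Finset (Tri m))]
      simp only [Finset.card_filter, Nat.cast_sum, Finset.mul_sum, ← Finset.sum_sub_distrib,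
        ← Finset.sum_add_distrib]
      refine Finset.sum_congr rfl fun v _ => ?_
      rw [hw]
      generalize 2 ^ (L.card + M.card + N.card - 1) = q at *
      have q1 : ¬ q = 3 * q := by omega
      have q2 : ¬ q + q = 3 * q := by omega
      have q3 : q + q + q = 3 * q := by omega
      have q4 : ¬ 0 = 3 * q := by omega
      rcases P_cases L M N v with ⟨p1, p2, p3, p0⟩ | ⟨p1, p2, p3, p0⟩ | ⟨p1, p2, p3, p0⟩ |
      ⟨p1, p2, p3, p0⟩ | ⟨p1, p2, p3, p0⟩ <;>
      simp [p1, p2, p3, p0, q1, q2, q3, q4, hpos.ne']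
    rw [key, c0, c1, c2, c3, ct]
    push_cast
    ring
  · rw [natcard_eq (fun v => wtL (cD (Dset (Δ L) (Δ M) (Δ N)) v) =
      2 ^ (L.card + M.card + N.card))]
    have key : ((Finset.univ.filter (fun v : Tri m => wtL (cD (Dset (Δ L) (Δ M) (Δ N)) (mkV v)) =
      2 ^ (L.card + M.card + N.card))).card : ℤ) =
      (Finset.univ.filter (fun v : Tri m => P1 L M N v)).card
      + (Finset.univ.filter (fun v : Tri m => P2 L M v)).card
      + (Finset.univ.filter (fun v : Tri m => P3 L M N v)).card
      - 3 * (Finset.univ.filter (fun v : Tri m => P0 L M N v)).card := by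
      simp only [Finset.card_filter, Nat.cast_sum, Finset.mul_sum, ← Finset.sum_sub_distrib,
        ← Finset.sum_add_distrib]
      refine Finset.sum_congr rfl fun v _ => ?_
      rw [hw, hss]
      generalize 2 ^ (L.card + M.card + N.card - 1) = q at *
      have q1 : ¬ q = 2 * q := by omega
      have q2 : q + q = 2 * q := by omega
      have q3 : ¬ 2 * q + q = 2 * q := by omega
      have q4 : ¬ 0 = 2 * q := by omega
      rcases P_cases L M N v with ⟨p1, p2, p3, p0⟩ | ⟨p1, p2, p3, p0⟩ | ⟨p1, p2, p3, p0⟩ |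
      ⟨p1, p2, p3, p0⟩ | ⟨p1, p2, p3, p0⟩ <;>
      simp [p1, p2, p3, p0, q1, q2, q3, q4, hpos.ne']
    rw [key, c0, c1, c2, c3]
    push_cast
    ring
  · rw [k0]; push_cast; rfl

end
end
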